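/- arXiv:1502.04690 — 4 statements merged into one kernel-verified Lean document; each statement's English description precedes it below -/
import Mathlib

section
/- Let G be a strongly connected finite directed multigraph on vertex set V. Then G is Eulerian (every vertex has indegree equal to outdegree) if and only if for every vertex s the element β̄_s is trivial in the sandpile group K(G,s), i.e. β_s lies in the integer column span Δ_s ℤ^{V∖{s}} of the reduced Laplacian. -/
open Finset

variable {V : Type} [Fintype V] [DecidableEq V]

/-- Outdegree of `v`. -/
def outdeg (d : V → V → ℕ) (v : V) : ℕ := ∑ w, d v w

/-- Indegree of `v`. -/
def indeg (d : V → V → ℕ) (v : V) : ℕ := ∑ w, d w v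

/-- The graph Laplacian. -/
def lap (d : V → V → ℕ) : Matrix V V ℤ :=
  Matrix.of fun v w => if v = w then (outdeg d v : ℤ) - d v v else -(d w v : ℤ)

/-- Strong connectivity. -/
def StronglyConnected (d : V → V → ℕ) : Prop :=
  ∀ u v : V, Relation.ReflTransGen (fun a b => 1 ≤ d a b) u v

/-- Eulerian: every vertex has indegree equal to outdegree. -/
def Eulerian (d : V → V → ℕ) : Prop := ∀ v, indeg d v = outdeg d v

/-- Reduced Laplacian with the row and column of `s` deleted. -/
def redLap (d : V → V → ℕ) (s : V) : Matrix {v : V // v ≠ s} {v : V // v ≠ s} ℤ :=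
  Matrix.of fun v w => lap d v.1 w.1

/-- Number of oriented spanning trees rooted at `s` (matrix-tree theorem). -/
def kappa (d : V → V → ℕ) (s : V) : ℤ := (redLap d s).det

/-- Pham index. -/
def phamIndex (d : V → V → ℕ) : ℤ := Finset.univ.gcd (kappa d)

/-- Integer column span of the Laplacian. -/
def lapLattice (d : V → V → ℕ) : Submodule ℤ (V → ℤ) :=
  LinearMap.range (lap d).mulVecLin

/-- Integer column span of the reduced Laplacian. -/
def redLattice (d : V → V → ℕ) (s : V) : Submodule ℤ ({v : V // v ≠ s} → ℤ) :=
  LinearMap.range (redLap d s).mulVecLin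

/-- Integer vectors with coordinate sum zero. -/
def zeroSum (V : Type) [Fintype V] : Submodule ℤ (V → ℤ) where
  carrier := {f | ∑ v, f v = 0}
  add_mem' := by
    intro a b ha hb
    simp only [Set.mem_setOf_eq] at *
    simp [Finset.sum_add_distrib, ha, hb]
  zero_mem' := by simp
  smul_mem' := by
    intro c f hf
    simp only [Set.mem_setOf_eq, Pi.smul_apply, smul_eq_mul] at *
    simp [← Finset.mul_sum, hf]

/-- The sandpile `β_s`, recording edge multiplicities out of `s`. -/
def betaS (d : V → V → ℕ) (s : V) : {v : V // v ≠ s} → ℤ := fun v => (d s v.1 : ℤ)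

/-- Stable chip configuration. -/
def Stable (d : V → V → ℕ) (σ : V → ℤ) : Prop := ∀ v, σ v < (outdeg d v : ℤ)

/-- Result of firing vertex `v`. -/
def fire (d : V → V → ℕ) (σ : V → ℤ) (v : V) : V → ℤ := fun w => σ w - lap d w v

/-- One legal firing step. -/
def LegalStep (d : V → V → ℕ) (σ τ : V → ℤ) : Prop :=
  ∃ v, (outdeg d v : ℤ) ≤ σ v ∧ τ = fire d σ v

/-- `σ` stabilizes if some legal firing sequence from `σ` ends in a stable configuration. -/
def Stabilizes (d : V → V → ℕ) (σ : V → ℤ) : Prop :=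
  ∃ τ, Relation.ReflTransGen (LegalStep d) σ τ ∧ Stable d τ

/-- Legal firing sequences, recorded as lists of fired vertices. -/
inductive LegalSeq (d : V → V → ℕ) : (V → ℤ) → List V → Prop
  | nil (σ : V → ℤ) : LegalSeq d σ []
  | cons (σ : V → ℤ) (v : V) (l : List V) :
      (outdeg d v : ℤ) ≤ σ v → LegalSeq d (fire d σ v) l → LegalSeq d σ (v :: l)

/-- Period vector. -/
def IsPeriodVec (d : V → V → ℕ) (p : V → ℕ) : Prop :=
  p ≠ 0 ∧ (lap d).mulVec (fun v => (p v : ℤ)) = 0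

/-- Simple directed path from `x` to `y`, as a list of distinct vertices. -/
def IsSimplePath (d : V → V → ℕ) (x y : V) (p : List V) : Prop :=
  p.Nodup ∧ p.head? = some x ∧ p.getLast? = some y ∧ p.Chain' (fun a b => 1 ≤ d a b)

/-- A row of the Laplacian applied to a vector. -/
lemma lap_mulVec_apply (d : V → V → ℕ) (y : V → ℤ) (v : V) :
    (lap d).mulVec y v = outdeg d v * y v - ∑ w, (d w v : ℤ) * y w := by
  have hentry (w : V) : lap d v w * y w =
      (if v = w then (outdeg d v : ℤ) * y v else 0) - (d w v : ℤ) * y w := by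
    by_cases hvw : v = w
    · subst hvw
      simp [lap, sub_mul]
    · simp [lap, hvw]
  simp [Matrix.mulVec, dotProduct, hentry, Finset.sum_sub_distrib]

/-- A vector in the image of the Laplacian has coordinate sum zero. -/
lemma sum_lap_mulVec (d : V → V → ℕ) (y : V → ℤ) : ∑ v, (lap d).mulVec y v = 0 := by
  simp only [lap_mulVec_apply, Finset.sum_sub_distrib, sub_eq_zero]
  rw [Finset.sum_comm]
  simp [outdeg, Finset.sum_mul]

/-- `β_s` lies in the reduced lattice iff the Laplacian kernel has a vector equal to `1` at `s`. -/
lemma betaS_mem_redLattice_iff (d : V → V → ℕ) (s : V) :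
    betaS d s ∈ redLattice d s ↔ ∃ y : V → ℤ, (lap d).mulVec y = 0 ∧ y s = 1 := by
  have hsplit (y : V → ℤ) (v : {v : V // v ≠ s}) : (lap d).mulVec y v.1 =
      -(d s v.1 : ℤ) * y s + (redLap d s).mulVec (fun w => y w.1) v := by
    simp only [Matrix.mulVec, dotProduct, redLap, Matrix.of_apply]
    rw [Fintype.sum_eq_add_sum_subtype_ne _ s]
    simp [lap, v.2]
  simp only [redLattice, LinearMap.mem_range, Matrix.mulVecLin_apply]
  constructor
  · rintro ⟨x, hx⟩
    set y : V → ℤ := fun v => if hv : v = s then 1 else x ⟨v, hv⟩ with hy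
    have hys : y s = 1 := by simp [hy]
    have hyx : (fun w : {v : V // v ≠ s} => y w.1) = x := by
      ext w
      simp [hy, w.2]
    have hne (v : {v : V // v ≠ s}) : (lap d).mulVec y v.1 = 0 := by
      rw [hsplit, hyx, hys, hx]
      simp [betaS]
    have hs : (lap d).mulVec y s = 0 := by
      have hsum := sum_lap_mulVec d y
      rw [Fintype.sum_eq_add_sum_subtype_ne _ s] at hsum
      simpa [hne] using hsum
    refine ⟨y, funext fun v => ?_, hys⟩
    by_cases hv : v = s
    · rw [hv, hs]
      rfl
    · exact hne ⟨v, hv⟩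
  · rintro ⟨y, hy, hys⟩
    refine ⟨fun w => y w.1, funext fun v => ?_⟩
    have hv := hsplit y v
    rw [hy, hys] at hv
    simp only [Pi.zero_apply] at hv
    simp only [betaS]
    linarith

/-- The constant vector `1` is in the Laplacian kernel iff the graph is Eulerian. -/
lemma eulerian_iff_lap_mulVec_one (d : V → V → ℕ) :
    Eulerian d ↔ (lap d).mulVec (fun _ => 1) = 0 := by
  simp only [Eulerian, funext_iff, lap_mulVec_apply, mul_one, Pi.zero_apply, sub_eq_zero]
  refine forall_congr' fun v => ?_
  rw [eq_comm, ← Nat.cast_inj (R := ℤ)]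
  simp [indeg]

/-- The Laplacian kernel is closed under taking absolute values. -/
lemma lap_mulVec_abs_eq_zero {d : V → V → ℕ} {y : V → ℤ} (hy : (lap d).mulVec y = 0) :
    (lap d).mulVec (fun v => |y v|) = 0 := by
  have hle (v : V) : (lap d).mulVec (fun v => |y v|) v ≤ 0 := by
    have hv := congrFun hy v
    rw [lap_mulVec_apply, Pi.zero_apply, sub_eq_zero] at hv
    rw [lap_mulVec_apply, sub_nonpos]
    calc (outdeg d v : ℤ) * |y v| = |∑ w, (d w v : ℤ) * y w| := by
          rw [← hv, abs_mul, Nat.abs_cast]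
      _ ≤ ∑ w, |(d w v : ℤ) * y w| := Finset.abs_sum_le_sum_abs _ _
      _ = ∑ w, (d w v : ℤ) * |y w| := by simp [abs_mul]
  have hzero := (Finset.sum_eq_zero_iff_of_nonpos fun v _ => hle v).1 (sum_lap_mulVec d _)
  exact funext fun v => hzero v (Finset.mem_univ v)

/-- On a strongly connected graph, a Laplacian kernel vector with a zero coordinate vanishes. -/
lemma StronglyConnected.eq_zero_of_lap_mulVec_eq_zero {d : V → V → ℕ} (h : StronglyConnected d)
    {y : V → ℤ} (hy : (lap d).mulVec y = 0) {t : V} (ht : y t = 0) (v : V) : y v = 0 := by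
  induction h v t using Relation.ReflTransGen.head_induction_on with
  | refl => exact ht
  | @head a b hab _ hb =>
    have hkey := congrFun (lap_mulVec_abs_eq_zero hy) b
    rw [lap_mulVec_apply, hb] at hkey
    simp only [abs_zero, mul_zero, zero_sub, Pi.zero_apply, neg_eq_zero] at hkey
    rw [Finset.sum_eq_zero_iff_of_nonneg fun w _ => by positivity] at hkey
    have ha := hkey a (Finset.mem_univ a)
    have hd : d a b ≠ 0 := Nat.one_le_iff_ne_zero.1 hab
    simpa [hd] using ha

theorem stmt2 (d : V → V → ℕ) (h : StronglyConnected d) :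
    Eulerian d ↔ ∀ s : V, betaS d s ∈ redLattice d s := by
  simp only [betaS_mem_redLattice_iff, eulerian_iff_lap_mulVec_one]
  refine ⟨fun h1 s => ⟨fun _ => 1, h1, rfl⟩, fun hall => ?_⟩
  cases isEmpty_or_nonempty V with
  | inl hV => exact funext fun v => hV.elim v
  | inr hV =>
    obtain ⟨s⟩ := hV
    obtain ⟨y, hy, hys⟩ := hall s
    have habs : (fun v => |y v|) = fun _ => 1 := by
      funext t
      obtain ⟨z, hz, hzt⟩ := hall t
      have hker : (lap d).mulVec (y - y t • z) = 0 := by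
        rw [Matrix.mulVec_sub, Matrix.mulVec_smul, hy, hz]
        simp
      have hs := h.eq_zero_of_lap_mulVec_eq_zero hker (t := t) (by simp [hzt]) s
      simp only [Pi.sub_apply, Pi.smul_apply, smul_eq_mul, hys, sub_eq_zero] at hs
      exact Int.isUnit_iff_abs_eq.1 (.of_mul_eq_one _ hs.symm)
    rw [← habs]
    exact lap_mulVec_abs_eq_zero hy
end

section
/- Let G be a strongly connected finite directed multigraph on vertex set V with Laplacian Δ, and let κ ∈ ℤ^V be the vector with κ(v) = det Δ_v, the determinant of the reduced Laplacian obtained by deleting the row and column of v. Then Δκ = 0. -/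
open Finset

variable {V : Type} [Fintype V] [DecidableEq V]

section

variable {n R : Type*} [Fintype n] [DecidableEq n] [CommRing R]

theorem Matrix.det_updateRow_sum_rows (A : Matrix n n R) (j : n) :
    (A.updateRow j fun w => ∑ k, A k w).det = A.det := by
  have h := A.det_updateRow_sum j (fun _ => 1)
  rw [one_smul] at h
  rw [← h]
  congr 2
  ext w
  refine Eq.trans ?_ (Finset.sum_apply w Finset.univ fun k : n => (1 : R) • (A k : n → R)).symm
  simp

theorem Matrix.det_eq_zero_of_sum_row_eq_zero (A : Matrix n n R) (i : n)
    (hA : ∀ w, ∑ k, A k w = 0) : A.det = 0 := by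
  rw [← A.det_updateRow_sum_rows i]
  exact Matrix.det_eq_zero_of_row_eq_zero i (by simp [hA])

theorem Matrix.det_updateRow_eq_of_sum_row_eq_zero (A : Matrix n n R) (hA : ∀ w, ∑ k, A k w = 0)
    (v : n → R) (i j : n) : (A.updateRow j v).det = (A.updateRow i v).det := by
  rcases eq_or_ne i j with rfl | hij
  · rfl
  have hdet : A.det = 0 := A.det_eq_zero_of_sum_row_eq_zero i hA
  set B := A.updateRow i (A i + v) with hB
  have hsum : (fun w => ∑ k, B k w) = v := by
    ext w
    have hBw : ∀ k, B k w = A k w + if k = i then v w else 0 := by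
      intro k
      rcases eq_or_ne k i with rfl | hk
      · simp [hB]
      · simp [hB, hk]
    simp [hBw, Finset.sum_add_distrib, hA]
  have h1 : B.det = (A.updateRow i v).det := by
    rw [hB, Matrix.det_updateRow_add, Matrix.updateRow_eq_self, hdet, zero_add]
  have h2 : (B.updateRow j v).det = B.det := by
    have := B.det_updateRow_sum_rows j
    rwa [hsum] at this
  have h3 : B.updateRow j v = (A.updateRow j v).updateRow i ((A.updateRow j v) i + v) := by
    ext a b
    simp only [hB, Matrix.updateRow_apply, Pi.add_apply]
    grind
  have h4 : ((A.updateRow j v).updateRow i v).det = 0 := by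
    apply Matrix.det_zero_of_row_eq hij
    ext b
    simp [Matrix.updateRow_apply, hij.symm]
  rw [← h1, ← h2, h3, Matrix.det_updateRow_add, Matrix.updateRow_eq_self, h4, add_zero]

theorem Matrix.adjugate_apply_self_eq_det (A : Matrix n n R) (i : n) :
    A.adjugate i i = (Matrix.of fun v w : {v : n // v ≠ i} => A v.1 w.1).det := by
  rw [Matrix.adjugate_apply, Matrix.twoBlockTriangular_det _ (fun v => v ≠ i)]
  · have h1 : (Matrix.toSquareBlockProp (A.updateRow i (Pi.single i 1)) fun v => ¬ v ≠ i) = 1 := by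
      ext ⟨a, ha⟩ ⟨b, hb⟩
      obtain rfl := not_not.mp ha
      obtain rfl := not_not.mp hb
      simp [Matrix.toSquareBlockProp]
    rw [h1, Matrix.det_one, mul_one]
    congr 1
    ext ⟨a, ha⟩ ⟨b, hb⟩
    simp [Matrix.toSquareBlockProp, ha]
  · intro a ha b hb
    obtain rfl := not_not.mp ha
    simp [hb]

end

theorem sum_lap_row (d : V → V → ℕ) (w : V) : ∑ k, lap d k w = 0 := by
  have h : ∀ k, lap d k w = (if k = w then (outdeg d w : ℤ) else 0) - d w k := by
    intro k
    rcases eq_or_ne k w with rfl | hk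
    · simp [lap]
    · simp [lap, hk]
  simp [h, outdeg]

theorem adjugate_lap_apply (d : V → V → ℕ) (i j : V) : (lap d).adjugate i j = kappa d i := by
  rw [kappa, redLap, ← Matrix.adjugate_apply_self_eq_det, Matrix.adjugate_apply,
    Matrix.adjugate_apply]
  exact Matrix.det_updateRow_eq_of_sum_row_eq_zero _ (sum_lap_row d) _ _ _

theorem stmt10 (d : V → V → ℕ) (h : StronglyConnected d) :
    (lap d).mulVec (kappa d) = 0 := by
  ext v
  have hv : (lap d * (lap d).adjugate) v v = 0 := by
    rw [Matrix.mul_adjugate,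
      (lap d).det_eq_zero_of_sum_row_eq_zero v (sum_lap_row d), zero_smul, Matrix.zero_apply]
  simpa [Matrix.mul_apply, adjugate_lap_apply, Matrix.mulVec, dotProduct] using hv
end

section
/- Let G be a strongly connected finite directed multigraph on vertex set V and let s ∈ V. Then the order of β̄_s in the sandpile group K(G,s) equals κ(s)/M_G, where M_G = gcd{κ(v) : v ∈ V}. Consequently the index of the cyclic subgroup ⟨β̄_s⟩ in K(G,s) equals M_G. -/
open Finset

variable {V : Type} [Fintype V] [DecidableEq V]

/-- The sum `∑ w, f w * Δ w v` is the outgoing difference of `f` at `v`. -/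
theorem sum_mul_lap (d : V → V → ℕ) (f : V → ℝ) (v : V) :
    ∑ w, f w * (lap d w v : ℝ) = ∑ w, (d v w : ℝ) * (f v - f w) := by
  have key : ∀ w, f w * (lap d w v : ℝ) =
      (if w = v then f v * (outdeg d v : ℝ) else 0) - d v w * f w := by
    intro w
    by_cases hw : w = v
    · subst hw
      simp [lap]
      ring
    · simp [lap, hw]
      ring
  simp only [key, Finset.sum_sub_distrib, Finset.sum_ite_eq', Finset.mem_univ, if_true, outdeg,
    Nat.cast_sum, mul_sub, ← Finset.sum_mul, mul_comm (f v)]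

/-- Maximum principle: a function vanishing at `s` which off `s` satisfies `t f + fΔ = 0` with
`0 ≤ t` is nonpositive. -/
theorem nonpos_of_add_sum_mul_lap_eq_zero {d : V → V → ℕ} (h : StronglyConnected d) {s : V}
    {f : V → ℝ} (hs : f s = 0) {t : ℝ} (ht : 0 ≤ t)
    (hf : ∀ v, v ≠ s → t * f v + ∑ w, f w * (lap d w v : ℝ) = 0) (v : V) : f v ≤ 0 := by
  obtain ⟨m, -, hm⟩ := Finset.exists_max_image Finset.univ f ⟨s, Finset.mem_univ s⟩
  refine (hm v (Finset.mem_univ v)).trans ?_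
  by_contra! hpos
  have step : ∀ u, f u = f m → ∀ w, 1 ≤ d u w → f w = f m := by
    intro u hu w hw
    have hus : u ≠ s := by
      rintro rfl
      linarith
    have hsum := hf u hus
    rw [sum_mul_lap] at hsum
    have hterm : ∀ x ∈ Finset.univ, 0 ≤ (d u x : ℝ) * (f u - f x) := fun x hx =>
      mul_nonneg (Nat.cast_nonneg _) (by linarith [hm x hx])
    have hzero : ∑ x, (d u x : ℝ) * (f u - f x) = 0 := by
      have h1 := Finset.sum_nonneg hterm
      have h2 : 0 ≤ t * f u := mul_nonneg ht (by linarith)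
      linarith
    have hw0 := (Finset.sum_eq_zero_iff_of_nonneg hterm).1 hzero w (Finset.mem_univ w)
    have hd : (d u w : ℝ) ≠ 0 := by
      have : d u w ≠ 0 := by omega
      exact_mod_cast this
    rcases mul_eq_zero.1 hw0 with h0 | h0
    · exact absurd h0 hd
    · linarith
  have reach : ∀ u, Relation.ReflTransGen (fun a b => 1 ≤ d a b) m u → f u = f m := by
    intro u hu
    induction hu with
    | refl => rfl
    | tail _ hbc ih => exact step _ ih _ hbc
  linarith [reach s (h m s)]

theorem eq_zero_of_add_sum_mul_lap_eq_zero {d : V → V → ℕ} (h : StronglyConnected d) {s : V}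
    {f : V → ℝ} (hs : f s = 0) {t : ℝ} (ht : 0 ≤ t)
    (hf : ∀ v, v ≠ s → t * f v + ∑ w, f w * (lap d w v : ℝ) = 0) (v : V) : f v = 0 := by
  refine le_antisymm (nonpos_of_add_sum_mul_lap_eq_zero h hs ht hf v) ?_
  have := nonpos_of_add_sum_mul_lap_eq_zero (f := fun v => -f v) (s := s) h (by simp [hs]) ht
    (fun v hv => by
      simp only [neg_mul, mul_neg, Finset.sum_neg_distrib]
      linarith [hf v hv]) v
  linarith

theorem det_redLap_add_scalar_ne_zero {d : V → V → ℕ} (h : StronglyConnected d) (s : V) {t : ℝ}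
    (ht : 0 ≤ t) : (Matrix.scalar _ t + (redLap d s).map (Int.cast : ℤ → ℝ)).det ≠ 0 := by
  intro hdet
  obtain ⟨g, hg0, hg⟩ := Matrix.exists_vecMul_eq_zero_iff.2 hdet
  refine hg0 (funext fun v => ?_)
  let f : V → ℝ := fun v => if hv : v ≠ s then g ⟨v, hv⟩ else 0
  have hfs : f s = 0 := by simp [f]
  have hfg : ∀ v : {v : V // v ≠ s}, f v = g v := fun v => by simp [f, v.2]
  have := eq_zero_of_add_sum_mul_lap_eq_zero h hfs ht (fun v hv => ?_) v.1
  · simpa [hfg] using this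
  · have hv' := congrFun hg ⟨v, hv⟩
    rw [Matrix.vecMul_add] at hv'
    simp only [Pi.add_apply, Matrix.scalar_apply, Matrix.vecMul_diagonal, Pi.zero_apply] at hv'
    rw [mul_comm, ← hv', ← Fintype.sum_subtype_add_sum_subtype (fun w => w ≠ s)]
    have h2 : ∑ w : {w : V // ¬ w ≠ s}, f w * (lap d w v : ℝ) = 0 :=
      Finset.sum_eq_zero fun w _ => by
        have : w.1 = s := not_not.1 w.2
        rw [this, hfs, zero_mul]
    rw [h2, add_zero]
    simp [Matrix.vecMul, dotProduct, redLap, hfg, show f v = g ⟨v, hv⟩ from hfg ⟨v, hv⟩]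

theorem kappa_pos {d : V → V → ℕ} (h : StronglyConnected d) (s : V) : 0 < kappa d s := by
  set A := (redLap d s).map (Int.cast : ℤ → ℝ) with hA
  have hdet : ((kappa d s : ℤ) : ℝ) = A.det := by
    rw [kappa, hA]
    exact (Int.castRingHom ℝ).map_det (redLap d s)
  have heval : ∀ t, (-A).charpoly.eval t = (Matrix.scalar _ t + A).det := fun t => by
    rw [Matrix.eval_charpoly, sub_neg_eq_add]
  have h0 : (-A).charpoly.eval 0 = A.det := by simp [heval]
  suffices 0 < (-A).charpoly.eval 0 by
    rw [h0, ← hdet] at this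
    exact_mod_cast this
  by_contra! hneg
  have hmonic := (-A).charpoly_monic
  rcases Nat.eq_zero_or_pos (-A).charpoly.natDegree with hd | hd
  · rw [hmonic.natDegree_eq_zero.1 hd] at hneg
    norm_num at hneg
  have htop := (-A).charpoly.tendsto_atTop_of_leadingCoeff_nonneg
    (Polynomial.natDegree_pos_iff_degree_pos.1 hd) (by simp [hmonic.leadingCoeff])
  obtain ⟨T, hT0, hT⟩ := ((Filter.eventually_ge_atTop (0 : ℝ)).and
    (htop.eventually_ge_atTop 0)).exists
  obtain ⟨t, ht, hroot⟩ := intermediate_value_Icc hT0 (-A).charpoly.continuous.continuousOn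
    ⟨hneg, hT⟩
  exact det_redLap_add_scalar_ne_zero h s ht.1 ((heval t).symm.trans hroot)

theorem sum_lap (d : V → V → ℕ) (v : V) : ∑ w, lap d w v = 0 := by
  have := sum_mul_lap d (fun _ => 1) v
  simp only [one_mul, sub_self, mul_zero, Finset.sum_const_zero] at this
  exact_mod_cast this

theorem det_lap (d : V → V → ℕ) (s : V) : (lap d).det = 0 :=
  Matrix.exists_vecMul_eq_zero_iff.1 ⟨fun _ => 1, fun h0 => one_ne_zero (congrFun h0 s), by
    ext v
    simp [Matrix.vecMul, dotProduct, sum_lap]⟩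

/-- The left kernel of the Laplacian consists of constant vectors. -/
theorem eq_of_vecMul_lap_eq_zero {d : V → V → ℕ} (h : StronglyConnected d) {f : V → ℤ}
    (hf : Matrix.vecMul f (lap d) = 0) (u v : V) : f u = f v := by
  have := eq_zero_of_add_sum_mul_lap_eq_zero (f := fun w => (f w : ℝ) - f v) h (sub_self _)
    le_rfl (fun w _ => ?_) u
  · exact_mod_cast sub_eq_zero.1 this
  · have h1 : ∑ x, f x * lap d x w = 0 := congrFun hf w
    have h2 := sum_lap d w
    have h1' : ∑ x, (f x : ℝ) * (lap d x w : ℝ) = 0 := by exact_mod_cast h1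
    have h2' : ∑ x, (lap d x w : ℝ) = 0 := by exact_mod_cast h2
    simp [sub_mul, Finset.sum_sub_distrib, ← Finset.mul_sum, h1', h2']

theorem adjugate_lap_self (d : V → V → ℕ) (v : V) : (lap d).adjugate v v = kappa d v := by
  rw [Matrix.adjugate_apply, Matrix.twoBlockTriangular_det _ (fun w => w ≠ v)]
  · have h1 : (Matrix.toSquareBlockProp ((lap d).updateRow v (Pi.single v 1))
        (fun w => ¬ w ≠ v)) = 1 := by
      ext i j
      have hi : i.1 = v := not_not.1 i.2
      have hj : j.1 = v := not_not.1 j.2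
      have hij : i = j := Subtype.ext (hi.trans hj.symm)
      subst hij
      simp [Matrix.toSquareBlockProp, hi]
    rw [h1, Matrix.det_one, mul_one, kappa]
    congr 1
    ext i j
    simp [Matrix.toSquareBlockProp, redLap, Matrix.updateRow_apply, i.2]
  · intro i hi j hj
    rw [not_not.1 hi, Matrix.updateRow_self, Pi.single_eq_of_ne hj]

theorem lap_mulVec_kappa {d : V → V → ℕ} (h : StronglyConnected d) :
    (lap d).mulVec (kappa d) = 0 := by
  ext v
  have hadj : ∀ w, (lap d).adjugate w v = kappa d w := fun w => by
    rw [← adjugate_lap_self]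
    refine eq_of_vecMul_lap_eq_zero h (f := (lap d).adjugate w) ?_ v w
    ext x
    have := congrFun (congrFun (lap d).adjugate_mul w) x
    rw [det_lap d v, zero_smul] at this
    exact this
  have := congrFun (congrFun (lap d).mul_adjugate v) v
  rw [det_lap d v, zero_smul, Matrix.mul_apply] at this
  simp only [hadj] at this
  exact this

theorem lap_mulVec_eq_zero_iff (d : V → V → ℕ) (s : V) (y : V → ℤ) :
    (lap d).mulVec y = 0 ↔
      (redLap d s).mulVec (fun v => y v) = y s • betaS d s := by
  have expand : ∀ v : {v : V // v ≠ s}, (lap d).mulVec y v =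
      (redLap d s).mulVec (fun v => y v) v - y s * betaS d s v := by
    intro v
    have hb : lap d v s = -betaS d s v := by simp [lap, betaS, v.2]
    rw [Matrix.mulVec, dotProduct, ← Finset.add_sum_erase _ _ (Finset.mem_univ s), hb,
      Finset.sum_subtype (p := fun w => w ≠ s) (Finset.univ.erase s) (by simp)
        (fun w => lap d v w * y w)]
    simp only [Matrix.mulVec, dotProduct, redLap, Matrix.of_apply]
    ring
  constructor
  · intro hy
    ext v
    have := expand v
    rw [hy] at this
    simpa using (sub_eq_zero.1 this.symm)
  · intro hy
    have off : ∀ v, v ≠ s → (lap d).mulVec y v = 0 := fun v hv => by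
      rw [expand ⟨v, hv⟩, hy]
      simp
    ext v
    by_cases hv : v = s
    · subst hv
      have hsum : ∑ w, (lap d).mulVec y w = 0 := by
        simp only [Matrix.mulVec, dotProduct]
        rw [Finset.sum_comm]
        simp [← Finset.sum_mul, sum_lap]
      rwa [Finset.sum_eq_single v (fun w _ hw => off w hw) (by simp)] at hsum
    · exact off v hv

/-- The right kernel of the Laplacian is spanned by `kappa`. -/
theorem kappa_mul_eq_of_lap_mulVec_eq_zero {d : V → V → ℕ} (h : StronglyConnected d) (s : V)
    {y : V → ℤ} (hy : (lap d).mulVec y = 0) (v : V) : kappa d s * y v = y s * kappa d v := by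
  set z : V → ℤ := kappa d s • y - y s • kappa d with hz
  have hz0 : (lap d).mulVec z = 0 := by
    rw [hz, Matrix.mulVec_sub, Matrix.mulVec_smul, Matrix.mulVec_smul, hy, lap_mulVec_kappa h]
    simp
  have hzs : z s = 0 := by simp [hz, mul_comm]
  rw [lap_mulVec_eq_zero_iff d s, hzs, zero_smul] at hz0
  have hzv : ∀ v, z v = 0 := fun v => by
    by_cases hv : v = s
    · rw [hv, hzs]
    · exact congrFun (Matrix.eq_zero_of_mulVec_eq_zero (kappa_pos h s).ne' hz0) ⟨v, hv⟩
  have := hzv v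
  simp only [hz, Pi.sub_apply, Pi.smul_apply, smul_eq_mul] at this
  linarith

theorem zsmul_betaS_mem_redLattice_iff (d : V → V → ℕ) (s : V) (k : ℤ) :
    k • betaS d s ∈ redLattice d s ↔ ∃ y : V → ℤ, (lap d).mulVec y = 0 ∧ y s = k := by
  constructor
  · rintro ⟨x, hx⟩
    refine ⟨fun v => if hv : v ≠ s then x ⟨v, hv⟩ else k, ?_, by simp⟩
    rw [lap_mulVec_eq_zero_iff d s]
    have : (fun v : {v : V // v ≠ s} => if hv : v.1 ≠ s then x ⟨v, hv⟩ else k) = x := by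
      ext v
      simp [v.2]
    rw [this]
    simpa using hx
  · rintro ⟨y, hy, rfl⟩
    exact ⟨_, (lap_mulVec_eq_zero_iff d s y).1 hy⟩

theorem phamIndex_dvd (d : V → V → ℕ) (v : V) : phamIndex d ∣ kappa d v :=
  Finset.gcd_dvd (Finset.mem_univ v)

theorem phamIndex_pos {d : V → V → ℕ} (h : StronglyConnected d) (s : V) : 0 < phamIndex d := by
  have hnonneg : 0 ≤ phamIndex d := by
    have : normalize (phamIndex d) = phamIndex d := Finset.normalize_gcd
    rw [← this, ← Int.abs_eq_normalize]
    exact abs_nonneg _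
  refine hnonneg.lt_of_ne fun h0 => (kappa_pos h s).ne' ?_
  exact zero_dvd_iff.1 (h0 ▸ phamIndex_dvd d s)

theorem zsmul_betaS_mem_redLattice_iff_dvd {d : V → V → ℕ} (h : StronglyConnected d) (s : V)
    (k : ℤ) : k • betaS d s ∈ redLattice d s ↔ kappa d s / phamIndex d ∣ k := by
  have hM := phamIndex_pos h s
  rw [zsmul_betaS_mem_redLattice_iff]
  constructor
  · rintro ⟨y, hy, rfl⟩
    have hdvd : kappa d s ∣ Finset.univ.gcd (fun v => y s * kappa d v) :=
      Finset.dvd_gcd fun v _ => ⟨y v, (kappa_mul_eq_of_lap_mulVec_eq_zero h s hy v).symm⟩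
    rw [Finset.gcd_mul_left] at hdvd
    have hdvd' : kappa d s ∣ y s * phamIndex d :=
      hdvd.trans (mul_dvd_mul_right (normalize_associated _).dvd _)
    rw [← Int.ediv_mul_cancel (phamIndex_dvd d s)] at hdvd'
    exact Int.dvd_of_mul_dvd_mul_right hM.ne' hdvd'
  · rintro ⟨c, rfl⟩
    refine ⟨fun v => kappa d v / phamIndex d * c, ?_, rfl⟩
    have hM' : (lap d).mulVec (phamIndex d • fun v => kappa d v / phamIndex d * c) = 0 := by
      have : (phamIndex d • fun v => kappa d v / phamIndex d * c) = c • kappa d := by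
        ext v
        simp only [Pi.smul_apply, smul_eq_mul]
        rw [← mul_assoc, Int.mul_ediv_cancel' (phamIndex_dvd d v), mul_comm]
      rw [this, Matrix.mulVec_smul, lap_mulVec_kappa h, smul_zero]
    rw [Matrix.mulVec_smul] at hM'
    exact (smul_eq_zero.1 hM').resolve_left hM.ne'

theorem card_quotient_range_mulVecLin {n : Type*} [Fintype n] [DecidableEq n] (A : Matrix n n ℤ)
    (hA : A.det ≠ 0) : Nat.card ((n → ℤ) ⧸ LinearMap.range A.mulVecLin) = A.det.natAbs := by
  have hinj : Function.Injective A.mulVecLin := by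
    rw [← LinearMap.ker_eq_bot, LinearMap.ker_eq_bot']
    exact fun x hx => Matrix.eq_zero_of_mulVec_eq_zero hA hx
  rw [← Submodule.natAbs_det_equiv _ (LinearEquiv.ofInjective A.mulVecLin hinj)]
  congr 1
  rw [← LinearMap.det_toLin']
  rfl

theorem stmt11 (d : V → V → ℕ) (h : StronglyConnected d) (s : V) :
    (addOrderOf (Submodule.Quotient.mk (p := redLattice d s) (betaS d s)) : ℤ)
        = kappa d s / phamIndex d ∧
    ((AddSubgroup.zmultiples
        (Submodule.Quotient.mk (p := redLattice d s) (betaS d s))).index : ℤ)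
        = phamIndex d := by
  have hκ := kappa_pos h s
  have hM := phamIndex_pos h s
  have hdiv : 0 < kappa d s / phamIndex d :=
    Int.ediv_pos_of_pos_of_dvd hκ hM.le (phamIndex_dvd d s)
  have horder : (addOrderOf (Submodule.Quotient.mk (p := redLattice d s) (betaS d s)) : ℤ)
      = kappa d s / phamIndex d := by
    have hiff : ∀ k : ℤ,
        (addOrderOf (Submodule.Quotient.mk (p := redLattice d s) (betaS d s)) : ℤ) ∣ k ↔
          kappa d s / phamIndex d ∣ k := fun k => by
      rw [addOrderOf_dvd_iff_zsmul_eq_zero, ← zsmul_betaS_mem_redLattice_iff_dvd h,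
        ← Submodule.Quotient.mk_smul, Submodule.Quotient.mk_eq_zero]
    exact Int.dvd_antisymm (Int.natCast_nonneg _) hdiv.le ((hiff _).2 dvd_rfl)
      ((hiff _).1 dvd_rfl)
  refine ⟨horder, ?_⟩
  have hcard := AddSubgroup.card_mul_index (AddSubgroup.zmultiples
    (Submodule.Quotient.mk (p := redLattice d s) (betaS d s)))
  rw [Nat.card_zmultiples, show Nat.card (({v : V // v ≠ s} → ℤ) ⧸ redLattice d s) =
    (kappa d s).natAbs from card_quotient_range_mulVecLin _ hκ.ne'] at hcard
  have hcard' := congrArg (Nat.cast : ℕ → ℤ) hcard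
  rw [Nat.cast_mul, horder, Int.natAbs_of_nonneg hκ.le] at hcard'
  refine mul_left_cancel₀ hdiv.ne' ?_
  rw [hcard', Int.ediv_mul_cancel (phamIndex_dvd d s)]
end

section
/- Let G be a strongly connected finite directed multigraph with primitive period vector π_G. If there is a legal firing sequence from a chip configuration σ in which every vertex v fires at least π_G(v) times, then σ does not stabilize. -/
open Finset

variable {V : Type} [Fintype V] [DecidableEq V]

theorem fire_eq_sub_mulVec_single (d : V → V → ℕ) (σ : V → ℤ) (v : V) :
    fire d σ v = σ - (lap d).mulVec (Pi.single v 1) := by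
  ext w
  simp [fire]

theorem mulVec_lap_nonpos_of_apply_eq_zero (d : V → V → ℕ) {w : V → ℤ} (hw : 0 ≤ w) {v : V}
    (hv : w v = 0) : (lap d).mulVec w v ≤ 0 := by
  refine Finset.sum_nonpos fun u _ => ?_
  by_cases huv : v = u
  · subst huv
    simp [hv]
  · have := mul_nonneg (Int.natCast_nonneg (d u v)) (hw u)
    simpa [lap, huv] using this

/-- Least action principle: a legal firing sequence fires each vertex at most as often as any
nonnegative firing vector that leads to a stable configuration. -/
theorem LegalSeq.count_le {d : V → V → ℕ} {σ : V → ℤ} {l : List V} (hl : LegalSeq d σ l)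
    {w : V → ℤ} (hw : 0 ≤ w) (hst : Stable d (σ - (lap d).mulVec w)) (x : V) :
    (l.count x : ℤ) ≤ w x := by
  induction hl generalizing w with
  | nil σ => simpa using hw x
  | cons σ v l hv _ ih =>
    have hpos : 0 < w v := by
      refine lt_of_le_of_ne (hw v) fun h0 => ?_
      have hle := mulVec_lap_nonpos_of_apply_eq_zero d hw h0.symm
      have hlt := hst v
      rw [Pi.sub_apply] at hlt
      linarith
    have hcount := ih (w := w - Pi.single v 1)
      (fun u => by
        by_cases huv : u = v
        · subst huv
          simp only [Pi.zero_apply, Pi.sub_apply, Pi.single_eq_same]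
          lia
        · simpa [huv] using hw u)
      (by
        rw [fire_eq_sub_mulVec_single, Matrix.mulVec_sub, sub_sub, add_sub_cancel]
        exact hst)
    by_cases hxv : x = v
    · subst hxv
      simp only [Pi.sub_apply, Pi.single_eq_same] at hcount
      simp only [List.count_cons_self]
      lia
    · simpa [hxv, List.count_cons_of_ne (Ne.symm hxv)] using hcount

theorem exists_legalSeq_of_reflTransGen {d : V → V → ℕ} {σ τ : V → ℤ}
    (h : Relation.ReflTransGen (LegalStep d) σ τ) :
    ∃ l, LegalSeq d σ l ∧ τ = σ - (lap d).mulVec (fun v => (l.count v : ℤ)) := by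
  induction h using Relation.ReflTransGen.head_induction_on with
  | refl => exact ⟨[], .nil τ, by simp [← Pi.zero_def]⟩
  | head hstep _ ih =>
    obtain ⟨v, hv, rfl⟩ := hstep
    obtain ⟨l, hl, rfl⟩ := ih
    refine ⟨v :: l, .cons _ v l hv hl, ?_⟩
    have hcount : (fun u => ((v :: l).count u : ℤ)) =
        Pi.single v 1 + fun u => (l.count u : ℤ) := by
      ext u
      by_cases huv : u = v
      · subst huv
        simp [add_comm]
      · simp [huv, List.count_cons_of_ne (Ne.symm huv)]
    rw [hcount, Matrix.mulVec_add, fire_eq_sub_mulVec_single, sub_sub]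

theorem stmt15 (d : V → V → ℕ) (h : StronglyConnected d) (π : V → ℕ)
    (hπ : IsPeriodVec d π ∧ Finset.univ.gcd π = 1)
    (σ : V → ℤ) (l : List V) (hl : LegalSeq d σ l)
    (hcount : ∀ v, π v ≤ l.count v) :
    ¬ Stabilizes d σ := by
  rintro ⟨τ, hστ, hτ⟩
  obtain ⟨m, hm, rfl⟩ := exists_legalSeq_of_reflTransGen hστ
  have hle : ∀ v, (π v : ℤ) ≤ m.count v := fun v =>
    (Int.ofNat_le.mpr (hcount v)).trans (hl.count_le (fun u => by simp) hτ v)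
  obtain ⟨⟨hne, hper⟩, -⟩ := hπ
  refine hne (funext fun v => ?_)
  have hmin := hm.count_le (w := (fun u => (m.count u : ℤ)) - fun u => (π u : ℤ))
    (fun u => sub_nonneg.mpr (hle u))
    (by rwa [Matrix.mulVec_sub, hper, sub_zero]) v
  simp only [Pi.sub_apply] at hmin
  simp only [Pi.zero_apply]
  lia
end
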